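/- arXiv:1502.03989 — 9 statements merged into one kernel-verified Lean document; each statement's English description precedes it below -/
import Mathlib

section
/- Let G be a connected finite simple graph, let S ⊆ V(G) be a set of terminals with |S| = p ≥ 2, and let F ⊆ V(G) be an inclusion-minimal set such that S ⊆ F and the induced subgraph G[F] is connected (i.e., no proper subset F' ⊊ F satisfies S ⊆ F' with G[F'] connected). Let X = {v ∈ F : v has degree at least 3 in G[F]} ∪ S. Then |X| ≤ 4p − 6. -/
/-- The graph `H` with all edges at `w` removed. -/
def avoidG {W : Type*} (H : SimpleGraph W) (w : W) : SimpleGraph W where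
  Adj a b := H.Adj a b ∧ a ≠ w ∧ b ≠ w
  symm := ⟨fun _ _ h => ⟨h.1.symm, h.2.2, h.2.1⟩⟩
  loopless := ⟨fun _ h => h.1.ne rfl⟩

lemma avoidG_mono {W : Type*} {T H : SimpleGraph W} (h : T ≤ H) (w : W) :
    avoidG T w ≤ avoidG H w := fun _ _ hab => ⟨h hab.1, hab.2⟩

lemma exists_nbr_avoid {W : Type*} {T : SimpleGraph W} {x w : W} (p : T.Walk x w) (hx : x ≠ w) :
    ∃ v, T.Adj w v ∧ (avoidG T w).Reachable v x := by
  induction p with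
  | nil => exact absurd rfl hx
  | @cons a b c h q ih =>
    by_cases hb : b = c
    · subst hb
      exact ⟨a, h.symm, SimpleGraph.Reachable.refl _⟩
    · obtain ⟨v, hv, hr⟩ := ih hb
      have : (avoidG T c).Adj b a := ⟨h.symm, hb, hx⟩
      exact ⟨v, hv, hr.trans this.reachable⟩

lemma induce_reach {W : Type*} {H : SimpleGraph W} {w a b : W} (p : (avoidG H w).Walk a b)
    (ha : a ≠ w) (hb : b ≠ w) :
    (H.induce ({w}ᶜ : Set W)).Reachable ⟨a, ha⟩ ⟨b, hb⟩ := by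
  induction p with
  | nil => exact SimpleGraph.Reachable.refl _
  | @cons a c b h q ih =>
    have h1 : (H.induce ({w}ᶜ : Set W)).Adj ⟨a, ha⟩ ⟨c, h.2.2⟩ := h.1
    exact h1.reachable.trans (ih h.2.2 hb)

/-- If all tree-neighbours of `w` are connected in `H - w`, then `H - w` is connected. -/
lemma conn_of_nbrs {W : Type*} [Nontrivial W] {T H : SimpleGraph W} (hT : T.Connected)
    (hTH : T ≤ H) (w : W)
    (h : ∀ a b, T.Adj w a → T.Adj w b → (avoidG H w).Reachable a b) :
    (H.induce ({w}ᶜ : Set W)).Connected := by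
  obtain ⟨z, hz⟩ := exists_ne w
  haveI : Nonempty ({w}ᶜ : Set W) := ⟨⟨z, hz⟩⟩
  refine SimpleGraph.Connected.mk ?_
  rintro ⟨a, ha⟩ ⟨b, hb⟩
  obtain ⟨pa⟩ := hT.preconnected a w
  obtain ⟨pb⟩ := hT.preconnected b w
  obtain ⟨a', ha', ra⟩ := exists_nbr_avoid pa ha
  obtain ⟨b', hb', rb⟩ := exists_nbr_avoid pb hb
  have ra := ra.mono (avoidG_mono hTH w)
  have rb := rb.mono (avoidG_mono hTH w)
  obtain ⟨q⟩ := (ra.symm.trans (h a' b' ha' hb')).trans rb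
  exact induce_reach q ha hb

/-- `v` charges its tree-neighbour `w`. -/
def Charges {W : Type*} (T H : SimpleGraph W) (v w : W) : Prop :=
  T.Adj w v ∧ ∃ v', v' ≠ v ∧ T.Adj w v' ∧ (avoidG H w).Reachable v v'

lemma exists_charge {W : Type*} {T H : SimpleGraph W} (hT : T.IsTree) (hTH : T ≤ H)
    {v u : W} (hvu : H.Adj v u) (hn : ¬ T.Adj v u) : ∃ w, Charges T H v w := by
  classical
  obtain ⟨p0⟩ := hT.connected.preconnected v u
  obtain ⟨p, hp⟩ := p0.toPath
  cases p with
  | nil => exact absurd hvu (H.irrefl)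
  | @cons _ w _ h q =>
    rw [SimpleGraph.Walk.cons_isPath_iff] at hp
    have huw : u ≠ w := fun e => hn (e ▸ h)
    obtain ⟨v', hv', r⟩ := exists_nbr_avoid q.reverse huw
    refine ⟨w, h.symm, v', ?_, hv', ?_⟩
    · rintro rfl
      have hb := (SimpleGraph.isAcyclic_iff_forall_adj_isBridge.1 hT.isAcyclic) h
      rw [SimpleGraph.isBridge_iff] at hb
      apply hb
      have h1 : (T.deleteEdges {s(v', w)}).Reachable v' u := by
        refine r.mono ?_
        intro a b hab
        rw [SimpleGraph.deleteEdges_adj]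
        refine ⟨hab.1, ?_⟩
        simp only [Set.mem_singleton_iff, Sym2.eq_iff]
        rintro (⟨_, e⟩ | ⟨e, _⟩)
        · exact hab.2.2 e
        · exact hab.2.1 e
      have h2 : (T.deleteEdges {s(v', w)}).Reachable w u :=
        ⟨q.toDeleteEdge s(v', w) (fun he => hp.2 (q.fst_mem_support_of_mem_edges he))⟩
      exact h1.trans h2.symm
    · have h1 : (avoidG H w).Adj v u := ⟨hvu, h.ne, huw⟩
      exact h1.reachable.trans (r.mono (avoidG_mono hTH w)).symm

lemma core {W : Type*} [Fintype W] [DecidableEq W] (H : SimpleGraph W) [DecidableRel H.Adj]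
    (hH : H.Connected) (S : Finset W) (hS : 2 ≤ S.card)
    (hmin : ∀ v, v ∉ S → ¬ (H.induce ({v}ᶜ : Set W)).Connected) :
    ((Finset.univ.filter (fun v => v ∉ S ∧ 3 ≤ H.degree v)).card : ℤ) ≤ 3 * S.card - 6 := by
  classical
  obtain ⟨T, hTH, hT⟩ := hH.exists_isTree_le
  haveI : Nontrivial W := by
    rw [← Fintype.one_lt_card_iff_nontrivial]
    exact lt_of_lt_of_le hS (Finset.card_le_univ S)
  have hdeg0 : ∀ v, 1 ≤ T.degree v := fun v =>
    hT.connected.preconnected.degree_pos_of_nontrivial v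
  have hdeg2 : ∀ v, v ∉ S → 2 ≤ T.degree v := by
    intro v hv
    by_contra hlt
    have h1 : T.degree v = 1 := by have := hdeg0 v; omega
    apply hmin v hv
    apply conn_of_nbrs hT.connected hTH v
    intro a b ha hb
    rw [← SimpleGraph.card_neighborFinset_eq_degree, Finset.card_eq_one] at h1
    obtain ⟨c, hc⟩ := h1
    have ha' : a ∈ T.neighborFinset v := by simpa using ha
    have hb' : b ∈ T.neighborFinset v := by simpa using hb
    rw [hc, Finset.mem_singleton] at ha' hb'
    rw [ha', hb']
  set c : W → Finset W := fun w => Finset.univ.filter (fun v => Charges T H v w) with hc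
  have hcsub : ∀ w, c w ⊆ T.neighborFinset w := by
    intro w v hv
    simp only [hc, Finset.mem_filter] at hv
    simpa using hv.2.1
  have hcle : ∀ w, (c w).card ≤ T.degree w := fun w => by
    rw [← SimpleGraph.card_neighborFinset_eq_degree]
    exact Finset.card_le_card (hcsub w)
  -- leaves receive no charge
  have hc1 : ∀ w, T.degree w = 1 → (c w).card = 0 := by
    intro w h1
    rw [← SimpleGraph.card_neighborFinset_eq_degree, Finset.card_eq_one] at h1
    obtain ⟨d, hd⟩ := h1
    rw [Finset.card_eq_zero, Finset.eq_empty_iff_forall_notMem]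
    intro v hv
    simp only [hc, Finset.mem_filter] at hv
    obtain ⟨-, ha, v', hne, hb, -⟩ := hv
    have ha' : v ∈ T.neighborFinset w := by simpa using ha
    have hb' : v' ∈ T.neighborFinset w := by simpa using hb
    rw [hd, Finset.mem_singleton] at ha' hb'
    exact hne (hb'.trans ha'.symm)
  have hc2 : ∀ w, w ∉ S → T.degree w = 2 → (c w).card = 0 := by
    intro w hw h1
    rw [← SimpleGraph.card_neighborFinset_eq_degree, Finset.card_eq_two] at h1
    obtain ⟨d, e, hde, hd⟩ := h1
    rw [Finset.card_eq_zero, Finset.eq_empty_iff_forall_notMem]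
    intro v hv
    simp only [hc, Finset.mem_filter] at hv
    obtain ⟨-, ha, v', hne, hb, hr⟩ := hv
    have key : ∀ x, T.Adj w x → x = d ∨ x = e := by
      intro x hx
      have hx' : x ∈ T.neighborFinset w := by simpa using hx
      simpa [hd] using hx'
    apply hmin w hw
    apply conn_of_nbrs hT.connected hTH w
    have hrs := hr.symm
    have k1 := key v ha
    have k2 := key v' hb
    have key2 : ∀ x, T.Adj w x → x = v ∨ x = v' := by
      intro x hx
      have := key x hx
      grind
    intro a b hxa hxb
    rcases key2 a hxa with rfl | rfl <;> rcases key2 b hxb with rfl | rfl <;>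
      first | exact hr | exact hrs | exact SimpleGraph.Reachable.refl _
  have hc3 : ∀ w, w ∉ S → T.degree w = 3 → (c w).card ≤ 2 := by
    intro w hw h1
    by_contra hlt
    have hcard : (c w).card = 3 := by have := hcle w; omega
    have heq : c w = T.neighborFinset w := by
      apply Finset.eq_of_subset_of_card_le (hcsub w)
      rw [SimpleGraph.card_neighborFinset_eq_degree]; omega
    rw [← SimpleGraph.card_neighborFinset_eq_degree, Finset.card_eq_three] at h1
    obtain ⟨x, y, z, hxy, hxz, hyz, hd⟩ := h1
    have key : ∀ a, T.Adj w a ↔ a = x ∨ a = y ∨ a = z := by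
      intro a
      rw [← SimpleGraph.mem_neighborFinset, hd]; simp
    have hch : ∀ a, T.Adj w a →
        ∃ v', v' ≠ a ∧ T.Adj w v' ∧ (avoidG H w).Reachable a v' := by
      intro a ha
      have : a ∈ c w := by rw [heq]; simpa using ha
      simp only [hc, Finset.mem_filter] at this
      exact this.2.2
    obtain ⟨x', hx1, hx2, hx3⟩ := hch x ((key x).2 (by simp))
    obtain ⟨y', hy1, hy2, hy3⟩ := hch y ((key y).2 (by simp))
    obtain ⟨z', hz1, hz2, hz3⟩ := hch z ((key z).2 (by simp))
    rw [key] at hx2 hy2 hz2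
    apply hmin w hw
    apply conn_of_nbrs hT.connected hTH w
    have hxy' : (avoidG H w).Reachable x y ∧ (avoidG H w).Reachable x z := by
      have tr : ∀ {a b c : W}, (avoidG H w).Reachable a b → (avoidG H w).Reachable b c →
        (avoidG H w).Reachable a c := fun h h' => h.trans h'
      have sy : ∀ {a b : W}, (avoidG H w).Reachable a b → (avoidG H w).Reachable b a :=
        fun h => h.symm
      generalize (avoidG H w).Reachable = R at *
      grind
    have hall : ∀ a, T.Adj w a → (avoidG H w).Reachable x a := by
      intro a ha
      rcases (key a).1 ha with rfl | rfl | rfl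
      · exact SimpleGraph.Reachable.refl _
      · exact hxy'.1
      · exact hxy'.2
    intro a b ha hb
    exact (hall a ha).symm.trans (hall b hb)
  -- local inequality
  have hloc : ∀ w, ((c w).card : ℤ) + (if w ∉ S ∧ 3 ≤ T.degree w then 1 else 0) ≤
      3 * ((T.degree w : ℤ) - 2) + (if w ∈ S then 3 else 0) := by
    intro w
    have e0 := hdeg0 w
    have e1 := hcle w
    have e2 := hc1 w
    by_cases hw : w ∈ S
    · simp only [hw, not_true_eq_false, false_and, if_false, if_true]
      omega
    · have e3 := hdeg2 w hw
      have e4 := hc2 w hw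
      have e5 := hc3 w hw
      simp only [hw, not_false_eq_true, true_and, if_false]
      split_ifs <;> omega
  have hsum := Finset.sum_le_sum (fun w (_ : w ∈ Finset.univ) => hloc w)
  have hdegsum : ∑ w, (T.degree w : ℤ) = 2 * ((Fintype.card W : ℤ) - 1) := by
    have h1 := T.sum_degrees_eq_twice_card_edges
    have h2 := hT.card_edgeFinset
    have h3 : (∑ w, T.degree w) + 2 = 2 * Fintype.card W := by omega
    have h4 : ((∑ w, T.degree w : ℕ) : ℤ) + 2 = 2 * Fintype.card W := by exact_mod_cast h3
    push_cast at h4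
    linarith
  have hrhs : ∑ w, (3 * ((T.degree w : ℤ) - 2) + (if w ∈ S then 3 else 0)) = 3 * S.card - 6 := by
    rw [Finset.sum_add_distrib, ← Finset.mul_sum, Finset.sum_sub_distrib, hdegsum]
    simp
    ring
  rw [hrhs] at hsum
  refine le_trans ?_ hsum
  rw [Finset.sum_add_distrib]
  have hsub : Finset.univ.filter (fun v => v ∉ S ∧ 3 ≤ H.degree v) ⊆
      (Finset.univ.biUnion c) ∪ Finset.univ.filter (fun v => v ∉ S ∧ 3 ≤ T.degree v) := by
    intro v hv
    simp only [Finset.mem_filter, Finset.mem_univ, true_and] at hv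
    by_cases h3 : 3 ≤ T.degree v
    · apply Finset.mem_union_right
      simp [hv.1, h3]
    · apply Finset.mem_union_left
      have : ∃ u, H.Adj v u ∧ ¬ T.Adj v u := by
        by_contra hno
        push Not at hno
        have : H.neighborFinset v ⊆ T.neighborFinset v := by
          intro u hu
          simp only [SimpleGraph.mem_neighborFinset] at hu ⊢
          exact hno u hu
        have := Finset.card_le_card this
        simp only [SimpleGraph.card_neighborFinset_eq_degree] at this
        omega
      obtain ⟨u, hu, hu'⟩ := this
      obtain ⟨w, hw⟩ := exists_charge hT hTH hu hu'
      simp only [Finset.mem_biUnion, Finset.mem_univ, true_and, hc, Finset.mem_filter]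
      exact ⟨w, hw⟩
  have h1 := Finset.card_le_card hsub
  have h2 := Finset.card_union_le (Finset.univ.biUnion c)
    (Finset.univ.filter (fun v => v ∉ S ∧ 3 ≤ T.degree v))
  have h3 : (Finset.univ.biUnion c).card ≤ ∑ w, (c w).card := Finset.card_biUnion_le
  have h4 : ∑ w, (if w ∉ S ∧ 3 ≤ T.degree w then (1 : ℤ) else 0) =
      (Finset.univ.filter (fun v => v ∉ S ∧ 3 ≤ T.degree v)).card := by
    simp
  rw [h4]
  exact_mod_cast (h1.trans h2).trans (Nat.add_le_add_right h3 _)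

/-- Lemma 2(i) of the paper: for a connected graph `G`, a terminal set `S` of size `p ≥ 2`
and an inclusion-minimal set `F ⊇ S` inducing a connected subgraph, the set `X` of vertices
of degree at least 3 in `G[F]` together with `S` has at most `4p - 6` elements. -/
theorem stmt_0 {V : Type*} [Fintype V] (G : SimpleGraph V) (hG : G.Connected)
    (S F : Set V) (p : ℕ) (hSp : S.ncard = p) (hp : 2 ≤ p)
    (hSF : S ⊆ F) (hFconn : (G.induce F).Connected)
    (hmin : ∀ F' : Set V, F' ⊂ F → S ⊆ F' → ¬ (G.induce F').Connected) :
    ({v ∈ F | 3 ≤ {u ∈ F | G.Adj v u}.ncard} ∪ S).ncard ≤ 4 * p - 6 := by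
  classical
  let S' : Finset F := Finset.univ.filter (fun v => (v : V) ∈ S)
  have hS'img : S = Subtype.val '' (S' : Set F) := by
    ext v
    simp only [S', Finset.coe_filter, Finset.mem_univ, true_and, Set.mem_image,
      Set.mem_setOf_eq, Subtype.exists, exists_and_left, exists_prop]
    constructor
    · intro hv
      exact ⟨v, hv, hSF hv, rfl⟩
    · rintro ⟨a, ha, _, rfl⟩
      exact ha
  have hS'card : S'.card = p := by
    rw [← hSp, hS'img, Set.ncard_image_of_injective _ Subtype.val_injective, Set.ncard_coe_finset]
  have hcut : ∀ v : F, v ∉ S' → ¬ ((G.induce F).induce ({v}ᶜ : Set F)).Connected := by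
    intro v hv hcon
    have hvS : (v : V) ∉ S := by simpa [S'] using hv
    refine hmin (F \ {(v : V)}) ?_ ?_ ?_
    · exact Set.diff_singleton_ssubset.2 v.2
    · intro x hx
      exact ⟨hSF hx, fun e => hvS (by rw [Set.mem_singleton_iff] at e; exact e ▸ hx)⟩
    · let f : ((G.induce F).induce ({v}ᶜ : Set F)) →g (G.induce (F \ {(v : V)})) :=
        { toFun := fun x => ⟨x.1.1, x.1.2, fun e => x.2 (Subtype.ext e)⟩
          map_rel' := fun h => h }
      refine hcon.map f ?_
      rintro ⟨x, hx, hxv⟩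
      exact ⟨⟨⟨x, hx⟩, fun e => hxv (congrArg Subtype.val e)⟩, rfl⟩
  have hcore := core (G.induce F) hFconn S' (by omega) hcut
  set A := Finset.univ.filter (fun v : F => v ∉ S' ∧ 3 ≤ (G.induce F).degree v) with hA
  have hdeg : ∀ v : F, (G.induce F).degree v = {u ∈ F | G.Adj v u}.ncard := by
    intro v
    rw [← SimpleGraph.card_neighborFinset_eq_degree, ← Set.ncard_coe_finset,
      ← Set.ncard_image_of_injective _ (Subtype.val_injective (p := fun x => x ∈ F))]
    congr 1
    ext u
    simp [and_comm]
  have hsub : ({v ∈ F | 3 ≤ {u ∈ F | G.Adj v u}.ncard} ∪ S) ⊆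
      (Subtype.val '' (A : Set F)) ∪ S := by
    rintro v (⟨hv, h3⟩ | hv)
    · by_cases hvS : v ∈ S
      · exact Or.inr hvS
      · left
        refine ⟨⟨v, hv⟩, ?_, rfl⟩
        simp only [hA, Finset.coe_filter, Set.mem_setOf_eq, Finset.mem_univ, true_and]
        refine ⟨by simpa [S'] using hvS, ?_⟩
        rw [hdeg]; exact h3
    · exact Or.inr hv
  have h1 := Set.ncard_le_ncard hsub (Set.toFinite _)
  have h2 := Set.ncard_union_le (Subtype.val '' (A : Set F)) S
  rw [Set.ncard_image_of_injective _ Subtype.val_injective, Set.ncard_coe_finset] at h2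
  omega
end

section
/- Let G be a connected finite simple graph, let S ⊆ V(G) be a set of terminals with |S| = p ≥ 2, and let F ⊆ V(G) be an inclusion-minimal set such that S ⊆ F and the induced subgraph G[F] is connected (i.e., no proper subset F' ⊊ F satisfies S ⊆ F' with G[F'] connected). Let X = {v ∈ F : v has degree at least 3 in G[F]} ∪ S. Then the number of vertices of F \ X that are adjacent in G[F] to some vertex of X is at most 4p − 6. -/
open Classical in
/-- Deleting a set of bridges creates at least one new component per bridge. -/
lemma aux_bridges {W : Type*} [Fintype W] (H : SimpleGraph W) (hH : H.Connected)
    (B : Finset (Sym2 W)) (hB : ∀ e ∈ B, e ∈ H.edgeSet ∧ H.IsBridge e) :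
    B.card + 1 ≤ Fintype.card (H.deleteEdges (B : Set (Sym2 W))).ConnectedComponent := by
  induction B using Finset.induction_on with
  | empty =>
    have := hH.nonempty
    have : Nonempty (H.deleteEdges ((∅ : Finset (Sym2 W)) : Set (Sym2 W))).ConnectedComponent :=
      this.map (SimpleGraph.connectedComponentMk _)
    rw [Finset.card_empty, zero_add]
    exact Fintype.card_pos
  | insert e B he ih =>
    have ih' := ih (fun e' h' => hB e' (Finset.mem_insert_of_mem h'))
    rw [Finset.card_insert_of_notMem he]
    have hle : H.deleteEdges ((insert e B : Finset (Sym2 W)) : Set (Sym2 W)) ≤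
        H.deleteEdges (B : Set (Sym2 W)) :=
      SimpleGraph.deleteEdges_anti (by simp)
    have hlt := Fintype.card_lt_of_surjective_not_injective _
      (SimpleGraph.ConnectedComponent.surjective_map_ofLE hle) ?_
    · omega
    · obtain ⟨hE, hbr⟩ := hB e (Finset.mem_insert_self _ _)
      induction e with
      | h a b =>
      intro hinj
      have h1 : (H.deleteEdges ((insert s(a,b) B : Finset (Sym2 W)) : Set (Sym2 W))).connectedComponentMk a
          = (H.deleteEdges ((insert s(a,b) B : Finset (Sym2 W)) : Set (Sym2 W))).connectedComponentMk b := by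
        apply hinj
        simp only [SimpleGraph.ConnectedComponent.map_mk]
        rw [SimpleGraph.ConnectedComponent.eq]
        apply SimpleGraph.Adj.reachable
        simp only [SimpleGraph.Hom.coe_ofLE, id, SimpleGraph.deleteEdges_adj]
        exact ⟨hE, he⟩
      rw [SimpleGraph.ConnectedComponent.eq] at h1
      rw [SimpleGraph.isBridge_iff] at hbr
      exact hbr (h1.mono (SimpleGraph.deleteEdges_anti (by simp)))

open Classical in
/-- Degree-two structure of a vertex outside `X`. -/
lemma aux_deg {W : Type*} [Fintype W] [Nontrivial W] (H : SimpleGraph W) (hH : H.Connected)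
    (u : W) (hcut : ¬ (H.induce {u}ᶜ).Connected) (hdeg : H.degree u ≤ 2) :
    H.degree u = 2 ∧ ∀ w, H.Adj u w → H.IsBridge s(u, w) := by
  have h0 : 0 < H.degree u := hH.preconnected.degree_pos_of_nontrivial u
  have h1 : H.degree u ≠ 1 := fun h => hcut (hH.induce_compl_singleton_of_degree_eq_one h)
  refine ⟨by omega, fun w hw => ?_⟩
  by_contra hb
  have hc := hH.connected_delete_edge_of_not_isBridge hb
  have h0' : 0 < (H.deleteEdges {s(u, w)}).degree u :=
    hc.preconnected.degree_pos_of_nontrivial u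
  have hlt : (H.deleteEdges {s(u, w)}).degree u < H.degree u := by
    rw [← SimpleGraph.card_neighborFinset_eq_degree, ← SimpleGraph.card_neighborFinset_eq_degree]
    apply Finset.card_lt_card
    rw [Finset.ssubset_iff_of_subset]
    · exact ⟨w, by simpa using hw, by simp⟩
    · intro z hz
      simp only [SimpleGraph.mem_neighborFinset, SimpleGraph.deleteEdges_adj] at hz ⊢
      exact hz.1
  have h1' : (H.deleteEdges {s(u, w)}).degree u = 1 := by omega
  refine hcut ((hc.induce_compl_singleton_of_degree_eq_one h1').mono ?_)
  intro a b hab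
  have hab' : (H.deleteEdges {s(u, w)}).Adj a.1 b.1 := hab
  exact (SimpleGraph.deleteEdges_le (G := H) _) hab'

/-- Replacing a part `K` by a connected subset `P` containing all attachment vertices
keeps connectivity. -/
lemma aux_attach {W : Type*} (H : SimpleGraph W) (hH : H.Connected)
    (K P : Set W) (x : W) (hx : x ∈ P) (hP : (H.induce P).Connected)
    (hA : ∀ a ∈ K, ∀ b ∉ K, H.Adj a b → a ∈ P) :
    (H.induce (Kᶜ ∪ P)).Connected := by
  have key : ∀ f g : W, ∀ w : H.Walk f g, g = x → ∀ hf : f ∈ Kᶜ ∪ P,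
      (H.induce (Kᶜ ∪ P)).Reachable ⟨f, hf⟩ ⟨x, Or.inr hx⟩ := by
    have hPr : ∀ f, ∀ hf : f ∈ P,
        (H.induce (Kᶜ ∪ P)).Reachable ⟨f, Or.inr hf⟩ ⟨x, Or.inr hx⟩ := by
      intro f hf
      have := hP.preconnected ⟨f, hf⟩ ⟨x, hx⟩
      exact this.map (SimpleGraph.induceHomOfLE H (Set.subset_union_right)).toHom
    intro f g w
    induction w with
    | nil => rintro rfl hf; rfl
    | @cons f y g h w ih =>
      intro hg hf
      by_cases hfP : f ∈ P
      · exact hPr f hfP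
      have hfK : f ∉ K := hf.resolve_right hfP
      have hy : y ∈ Kᶜ ∪ P := by
        by_cases hyK : y ∈ K
        · exact Or.inr (hA y hyK f hfK h.symm)
        · exact Or.inl hyK
      have hadj : (H.induce (Kᶜ ∪ P)).Adj ⟨f, hf⟩ ⟨y, hy⟩ := h
      exact hadj.reachable.trans (ih hg hy)
  have : Nonempty ↥(Kᶜ ∪ P) := ⟨⟨x, Or.inr hx⟩⟩
  refine ⟨fun a b => ?_⟩
  have r : ∀ a : ↥(Kᶜ ∪ P), (H.induce (Kᶜ ∪ P)).Reachable a ⟨x, Or.inr hx⟩ := by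
    intro a
    obtain ⟨w⟩ := hH.preconnected a.1 x
    exact key a.1 x w rfl a.2
  exact (r a).trans (r b).symm

open Classical in
/-- A component `K` without terminals and without vertices of degree at most two has at least
three outgoing edges. Here `H'` consists of the inner edges, `D` of the others. -/
lemma aux_three {W : Type*} [Fintype W] (H H' D : SimpleGraph W) (hH : H.Connected)
    (S : Set W) (hmin : ∀ F' : Set W, S ⊆ F' → (H.induce F').Connected → F' = Set.univ)
    (hsup : ∀ a b, H.Adj a b ↔ H'.Adj a b ∨ D.Adj a b)
    (K : H'.ConnectedComponent) (hKS : ∀ v ∈ K.supp, v ∉ S)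
    (hK3 : ∀ v ∈ K.supp, 3 ≤ H.degree v)
    (x : W) (hx : x ∈ K.supp) (hxD : 1 ≤ D.degree x) :
    3 ≤ ∑ v with H'.connectedComponentMk v = K, D.degree v := by
  by_contra hlt
  push Not at hlt
  have hmem : ∀ v, v ∈ K.supp ↔ H'.connectedComponentMk v = K := fun v => Iff.rfl
  have hclosed : ∀ a ∈ K.supp, ∀ b, H'.Adj a b → b ∈ K.supp := by
    intro a ha b hab
    exact (SimpleGraph.ConnectedComponent.mem_supp_congr_adj K hab).1 ha
  have hout : ∀ a ∈ K.supp, ∀ b ∉ K.supp, H.Adj a b → 1 ≤ D.degree a := by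
    intro a ha b hb hab
    rcases (hsup a b).1 hab with h | h
    · exact absurd (hclosed a ha b h) hb
    · rw [Nat.one_le_iff_ne_zero, ← Nat.pos_iff_ne_zero, SimpleGraph.degree_pos_iff_exists_adj]
      exact ⟨b, h⟩
  -- two attachment vertices
  obtain ⟨x2, hx2, hA⟩ : ∃ x2 ∈ K.supp, ∀ a ∈ K.supp, 1 ≤ D.degree a → (a = x ∨ a = x2) := by
    by_contra hcon
    push Not at hcon
    obtain ⟨y, hy, hyD, hyx, -⟩ := hcon x hx
    obtain ⟨z, hz, hzD, hzx, hzy⟩ := hcon y hy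
    have hsub : ({x, y, z} : Finset W) ⊆ Finset.univ.filter
        (fun v => H'.connectedComponentMk v = K) := by
      intro v hv
      simp only [Finset.mem_insert, Finset.mem_singleton] at hv
      simp only [Finset.mem_filter, Finset.mem_univ, true_and]
      rcases hv with rfl | rfl | rfl <;> assumption
    have h1 := Finset.sum_le_sum_of_subset (f := fun v => D.degree v) hsub
    rw [Finset.sum_insert (by simp [hyx.symm, hzx.symm]),
      Finset.sum_insert (by simp [hzy.symm]), Finset.sum_singleton] at h1
    omega
  -- we may choose `x2` with positive degree
  obtain ⟨x2, hx2, hx2D, hA⟩ : ∃ x2 ∈ K.supp, 1 ≤ D.degree x2 ∧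
      ∀ a ∈ K.supp, 1 ≤ D.degree a → (a = x ∨ a = x2) := by
    by_cases h : 1 ≤ D.degree x2
    · exact ⟨x2, hx2, h, hA⟩
    · refine ⟨x, hx, hxD, fun a ha haD => ?_⟩
      rcases hA a ha haD with h' | h'
      · exact Or.inl h'
      · exact absurd (h' ▸ haD) h
  have hreach : H'.Reachable x x2 := by
    rw [← SimpleGraph.ConnectedComponent.eq]
    exact hx.trans hx2.symm
  obtain ⟨w, hw⟩ := hreach.exists_walk_length_eq_dist
  have hle : H' ≤ H := fun a b h => (hsup a b).2 (Or.inl h)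
  have hPK : {v | v ∈ w.support} ⊆ K.supp := by
    intro v hv
    have : H'.Reachable x v := ⟨w.takeUntil v hv⟩
    rw [← SimpleGraph.ConnectedComponent.eq] at this
    exact this.symm.trans hx
  have hPc : (H.induce {v | v ∈ w.support}).Connected :=
    w.connected_induce_support.mono (fun a b h => hle h)
  have huniv := hmin (K.suppᶜ ∪ {v | v ∈ w.support}) (fun s hs => Or.inl (fun hsK => hKS s hsK hs))
    (aux_attach H hH K.supp {v | v ∈ w.support} x w.start_mem_support hPc (by
      intro a ha b hb hab
      rcases hA a ha (hout a ha b hb hab) with rfl | rfl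
      · exact w.start_mem_support
      · exact w.end_mem_support))
  have hKP : ∀ v ∈ K.supp, v ∈ w.support := by
    intro v hv
    have : v ∈ K.suppᶜ ∪ {v | v ∈ w.support} := huniv ▸ Set.mem_univ v
    rcases this with h | h
    · exact absurd hv h
    · exact h
  -- neighbours of x in H'
  have hnb : ∀ z, H'.Adj x z → z = w.getVert 1 ∧ 1 ≤ w.length := by
    intro z hz
    have hzK := hKP z (hclosed x hx z hz)
    rw [SimpleGraph.Walk.mem_support_iff_exists_getVert] at hzK
    obtain ⟨i, hi, hil⟩ := hzK
    have hi0 : i ≠ 0 := by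
      rintro rfl
      rw [SimpleGraph.Walk.getVert_zero] at hi
      exact hz.ne hi
    have hd : H'.dist x x2 ≤ 1 + (w.length - i) := by
      subst hi
      have := SimpleGraph.dist_le (SimpleGraph.Walk.cons hz (w.drop i))
      rw [SimpleGraph.Walk.length_cons, SimpleGraph.Walk.drop_length] at this
      omega
    have : i = 1 := by omega
    subst this
    exact ⟨hi.symm, hil⟩
  have hdeg : H.degree x ≤ H'.degree x + D.degree x := by
    simp only [← SimpleGraph.card_neighborFinset_eq_degree]
    refine le_trans (Finset.card_le_card ?_) (Finset.card_union_le _ _)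
    intro z hz
    simp only [Finset.mem_union, SimpleGraph.mem_neighborFinset] at hz ⊢
    exact (hsup x z).1 hz
  have h3 := hK3 x hx
  have hd1 : H'.degree x ≤ 1 := by
    rw [← SimpleGraph.card_neighborFinset_eq_degree]
    rw [Finset.card_le_one]
    intro a ha b hb
    simp only [SimpleGraph.mem_neighborFinset] at ha hb
    rw [(hnb a ha).1, (hnb b hb).1]
  by_cases hxx : x = x2
  · have hd0 : H'.degree x = 0 := by
      by_contra hne
      obtain ⟨z, hz⟩ := (SimpleGraph.degree_pos_iff_exists_adj _ _).1 (Nat.pos_of_ne_zero hne)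
      have := (hnb z hz).2
      subst hxx
      rw [SimpleGraph.dist_self] at hw
      omega
    have := Finset.single_le_sum (s := Finset.univ.filter
      (fun v => H'.connectedComponentMk v = K)) (f := fun v => D.degree v)
      (fun _ _ => Nat.zero_le _) (Finset.mem_filter.2 ⟨Finset.mem_univ x, hx⟩)
    omega
  · have hsub : ({x, x2} : Finset W) ⊆ Finset.univ.filter
        (fun v => H'.connectedComponentMk v = K) := by
      intro v hv
      simp only [Finset.mem_insert, Finset.mem_singleton] at hv
      simp only [Finset.mem_filter, Finset.mem_univ, true_and]
      rcases hv with rfl | rfl <;> assumption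
    have h1 := Finset.sum_le_sum_of_subset (f := fun v => D.degree v) hsub
    rw [Finset.sum_insert (by simp [hxx]), Finset.sum_singleton] at h1
    omega

open Classical in
lemma aux_main {W : Type*} [Fintype W] (H : SimpleGraph W) (hH : H.Connected)
    (S : Finset W) (hp : 2 ≤ S.card)
    (hmin : ∀ F' : Set W, ↑S ⊆ F' → (H.induce F').Connected → F' = Set.univ)
    (X : Finset W) (hX : ∀ v, v ∈ X ↔ 3 ≤ H.degree v ∨ v ∈ S) :
    (Finset.univ.filter (fun v => v ∉ X ∧ ∃ u ∈ X, H.Adj v u)).card ≤ 4 * S.card - 6 := by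
  have : Nontrivial W := by
    obtain ⟨a, _, b, _, hab⟩ := Finset.one_lt_card.1 (show 1 < S.card by omega)
    exact ⟨a, b, hab⟩
  by_cases hU : ∃ u, u ∉ X
  swap
  · push Not at hU
    rw [Finset.filter_false_of_mem (by intro v _; simp [hU v])]
    simp
  have hcut : ∀ u, u ∉ X → H.degree u = 2 ∧ ∀ w, H.Adj u w → H.IsBridge s(u, w) := by
    intro u hu
    rw [hX] at hu
    push Not at hu
    refine aux_deg H hH u (fun hc => ?_) (by omega)
    have h := hmin _ (fun s hs => ?_) hc
    · have : u ∈ ({u}ᶜ : Set W) := h ▸ Set.mem_univ u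
      exact this rfl
    · rintro rfl
      exact hu.2 hs
  obtain ⟨D, hDadj⟩ : ∃ D : SimpleGraph W,
      ∀ a b, D.Adj a b ↔ H.Adj a b ∧ (a ∉ X ∨ b ∉ X) :=
    ⟨{ Adj := fun a b => H.Adj a b ∧ (a ∉ X ∨ b ∉ X)
       symm := ⟨fun a b h => ⟨h.1.symm, h.2.symm⟩⟩
       loopless := ⟨fun a h => h.1.ne rfl⟩ }, fun _ _ => Iff.rfl⟩
  let B := D.edgeFinset
  let H' := H.deleteEdges (B : Set (Sym2 W))
  have hH'adj : ∀ a b, H'.Adj a b ↔ H.Adj a b ∧ ¬ D.Adj a b := by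
    intro a b
    simp [H', B]
  have hcomp : B.card + 1 ≤ Fintype.card H'.ConnectedComponent := by
    apply aux_bridges H hH B
    intro e he
    induction e with
    | h a b =>
    have he' := (hDadj a b).1 (by simpa [B] using he)
    refine ⟨he'.1, ?_⟩
    rcases he'.2 with h | h
    · exact (hcut a h).2 b he'.1
    · rw [Sym2.eq_swap]
      exact (hcut b h).2 a he'.1.symm
  have hsup : ∀ a b, H.Adj a b ↔ H'.Adj a b ∨ D.Adj a b := by
    intro a b
    rw [hH'adj, hDadj]
    tauto
  have hDU : ∀ u, u ∉ X → D.degree u = 2 := by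
    intro u hu
    rw [← (hcut u hu).1, ← SimpleGraph.card_neighborFinset_eq_degree,
      ← SimpleGraph.card_neighborFinset_eq_degree]
    congr 1
    ext z
    simp [hDadj, hu]
  -- every component has an outgoing edge
  have hattach : ∀ K : H'.ConnectedComponent, ∃ x ∈ K.supp, 1 ≤ D.degree x := by
    intro K
    by_contra hcon
    push Not at hcon
    have hcl : ∀ f g : W, ∀ w : H.Walk f g, f ∈ K.supp → g ∈ K.supp := by
      intro f g w
      induction w with
      | nil => exact id
      | @cons f y g h w ih =>
        intro hf
        apply ih
        rcases (hsup _ _).1 h with h' | h'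
        · exact (SimpleGraph.ConnectedComponent.mem_supp_congr_adj K h').1 hf
        · have h1 := hcon f hf
          have h2 := (SimpleGraph.degree_pos_iff_exists_adj D f).2 ⟨y, h'⟩
          omega
    obtain ⟨v, hv⟩ := K.nonempty_supp
    obtain ⟨u, hu⟩ := hU
    obtain ⟨w⟩ := hH.preconnected v u
    have h1 := hcon u (hcl v u w hv)
    have h2 := hDU u hu
    omega
  let f : W → ℕ := fun v => D.degree v + (if v ∈ S then 2 else 0) + (if v ∈ X then 0 else 1)
  have hfib : ∀ K : H'.ConnectedComponent,
      3 ≤ ∑ v with H'.connectedComponentMk v = K, f v := by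
    intro K
    have hsingle : ∀ v ∈ K.supp, f v ≤ ∑ v with H'.connectedComponentMk v = K, f v := by
      intro v hv
      exact Finset.single_le_sum (f := f) (fun _ _ => Nat.zero_le _)
        (Finset.mem_filter.2 ⟨Finset.mem_univ v, hv⟩)
    obtain ⟨x, hx, hxD⟩ := hattach K
    by_cases h1 : ∃ u ∈ K.supp, u ∉ X
    · obtain ⟨u, huK, hu⟩ := h1
      refine le_trans ?_ (hsingle u huK)
      simp only [f, hDU u hu, hu, if_false]
      omega
    push Not at h1
    by_cases h2 : ∃ s ∈ K.supp, s ∈ S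
    · obtain ⟨s, hsK, hs⟩ := h2
      have hfs : 2 + D.degree s ≤ f s := by
        simp only [f, hs, if_true]; omega
      by_cases hxs : x = s
      · subst hxs
        have := hsingle x hx
        omega
      · have hsub : ({x, s} : Finset W) ⊆ Finset.univ.filter
            (fun v => H'.connectedComponentMk v = K) := by
          intro v hv
          simp only [Finset.mem_insert, Finset.mem_singleton] at hv
          simp only [Finset.mem_filter, Finset.mem_univ, true_and]
          rcases hv with rfl | rfl <;> assumption
        have h1 := Finset.sum_le_sum_of_subset (f := f) hsub
        rw [Finset.sum_insert (by simp [hxs]), Finset.sum_singleton] at h1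
        have hfx : D.degree x ≤ f x := by simp only [f]; omega
        omega
    push Not at h2
    refine le_trans (aux_three H H' D hH S hmin hsup K h2 (fun v hv => ?_) x hx hxD)
      (Finset.sum_le_sum (fun v _ => by simp only [f]; omega))
    exact ((hX v).1 (h1 v hv)).resolve_right (h2 v hv)
  have hsum : 3 * Fintype.card H'.ConnectedComponent ≤ ∑ v, f v := by
    rw [← Finset.sum_fiberwise Finset.univ (fun v => H'.connectedComponentMk v) f]
    calc 3 * Fintype.card H'.ConnectedComponent = ∑ K : H'.ConnectedComponent, 3 := by
          simp [mul_comm]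
      _ ≤ _ := Finset.sum_le_sum (fun K _ => hfib K)
  have hf : ∑ v, f v = 2 * B.card + 2 * S.card + Xᶜ.card := by
    simp only [f, Finset.sum_add_distrib]
    rw [SimpleGraph.sum_degrees_eq_twice_card_edges]
    congr 1
    · congr 1
      rw [← Finset.sum_filter]
      simp [mul_comm]
    · rw [Finset.card_eq_sum_ones, ← Finset.sum_filter_add_sum_filter_not Finset.univ (· ∈ X)]
      rw [Finset.sum_ite_of_true (by simp), Finset.sum_ite_of_false (by simp)]
      simp only [Finset.sum_const_zero, zero_add]
      congr 1
      ext v; simp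
  have hsplit : ∑ v ∈ X, D.degree v + 2 * Xᶜ.card = 2 * B.card := by
    rw [← SimpleGraph.sum_degrees_eq_twice_card_edges, ← Finset.sum_add_sum_compl X]
    congr 1
    rw [Finset.sum_congr rfl (fun v hv => hDU v (Finset.mem_compl.1 hv))]
    simp [mul_comm]
  have hN : (Finset.univ.filter (fun v => v ∉ X ∧ ∃ u ∈ X, H.Adj v u)).card
      ≤ ∑ v ∈ X, D.degree v := by
    refine le_trans (Finset.card_le_card (t := X.biUnion (fun x => D.neighborFinset x)) ?_)
      Finset.card_biUnion_le
    intro v hv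
    simp only [Finset.mem_filter, Finset.mem_univ, true_and] at hv
    obtain ⟨hv, u, hu, huv⟩ := hv
    simp only [Finset.mem_biUnion, SimpleGraph.mem_neighborFinset]
    exact ⟨u, hu, (hDadj u v).2 ⟨huv.symm, Or.inr hv⟩⟩
  omega

/-- Lemma 2(ii) of the paper: with `X` the set of vertices of degree at least 3 in `G[F]`
together with `S`, the number of vertices of `F \ X` adjacent in `G[F]` to a vertex of `X`
is at most `4p - 6`. -/
theorem stmt_1 {V : Type*} [Fintype V] (G : SimpleGraph V) (hG : G.Connected)
    (S F : Set V) (p : ℕ) (hSp : S.ncard = p) (hp : 2 ≤ p)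
    (hSF : S ⊆ F) (hFconn : (G.induce F).Connected)
    (hmin : ∀ F' : Set V, F' ⊂ F → S ⊆ F' → ¬ (G.induce F').Connected)
    (X : Set V) (hX : X = {v ∈ F | 3 ≤ {u ∈ F | G.Adj v u}.ncard} ∪ S) :
    {v ∈ F | v ∉ X ∧ ∃ u ∈ X, G.Adj v u}.ncard ≤ 4 * p - 6 := by
  classical
  let S' : Finset F := Finset.univ.filter (fun v => v.1 ∈ S)
  let X' : Finset F := Finset.univ.filter (fun v => v.1 ∈ X)
  have hXF : X ⊆ F := by
    rw [hX]
    exact Set.union_subset (fun v hv => hv.1) hSF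
  have key : ∀ (Q : V → Prop), {v ∈ F | Q v}.ncard =
      (Finset.univ.filter (fun v : F => Q v.1)).card := by
    intro Q
    have : {v ∈ F | Q v} = Subtype.val '' {v : F | Q v.1} := by
      ext v
      simp only [Set.mem_ofPred_eq, Set.mem_image, Subtype.exists, exists_and_left,
        exists_prop, exists_eq_right_right]
      tauto
    rw [this, Set.ncard_image_of_injective _ Subtype.val_injective, Set.ncard_eq_toFinset_card']
    congr 1
    ext v; simp
  have hS : S'.card = p := by
    rw [← hSp, ← key (fun v => v ∈ S)]
    congr 1
    ext v
    exact ⟨fun h => h.2, fun h => ⟨hSF h, h⟩⟩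
  have hdeg : ∀ (v : F) [Fintype ((G.induce F).neighborSet v)], {u ∈ F | G.Adj v u}.ncard = (G.induce F).degree v := by
    intro v _
    rw [key (fun u => G.Adj v u), ← SimpleGraph.card_neighborFinset_eq_degree]
    congr 1
    ext u; simp
  have hmain := aux_main (G.induce F) hFconn S' (by omega) ?_ X' ?_
  · rw [key (fun v => v ∉ X ∧ ∃ u ∈ X, G.Adj v u), ← hS]
    refine le_trans (Finset.card_le_card ?_) hmain
    intro v hv
    simp only [Finset.mem_filter, Finset.mem_univ, true_and] at hv
    obtain ⟨hv, u, hu, huv⟩ := hv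
    simp only [Finset.mem_filter, Finset.mem_univ, true_and]
    refine ⟨by simpa [X'] using hv, ⟨u, hXF hu⟩, by simpa [X'] using hu, huv⟩
  · intro F' hSF' hc
    by_contra hne
    refine hmin (Subtype.val '' F') ?_ ?_ ?_
    · refine ⟨fun v hv => ?_, fun h => hne ?_⟩
      · obtain ⟨a, -, rfl⟩ := hv
        exact a.2
      · ext v
        simp only [Set.mem_univ, iff_true]
        obtain ⟨a, ha, hav⟩ := h v.2
        rwa [← Subtype.ext hav]
    · intro s hs
      exact ⟨⟨s, hSF hs⟩, hSF' (by simpa [S'] using hs), rfl⟩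
    · let φ : (G.induce F).induce F' →g G.induce (Subtype.val '' F') :=
        { toFun := fun a => ⟨a.1.1, a.1, a.2, rfl⟩
          map_rel' := fun h => h }
      refine hc.map φ ?_
      rintro ⟨_, a, ha, rfl⟩
      exact ⟨⟨a, ha⟩, rfl⟩
  · intro v
    simp only [X', S', Finset.mem_filter, Finset.mem_univ, true_and]
    rw [hX]
    constructor
    · rintro (h | h)
      · exact Or.inl (le_of_le_of_eq h.2 (@hdeg v _))
      · exact Or.inr h
    · rintro (h | h)
      · exact Or.inl ⟨v.2, le_of_le_of_eq h (@hdeg v _).symm⟩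
      · exact Or.inr h
end

section
/- (Isolation Lemma) Let U be a finite set and let 𝓕 ⊆ 2^U be a nonempty family of subsets of U. For each u ∈ U choose a weight w(u) ∈ {1, …, N} uniformly and independently at random, and for S ⊆ U let w(S) = Σ_{u∈S} w(u). Say that w isolates 𝓕 if there is a unique S' ∈ 𝓕 with w(S') = min_{S∈𝓕} w(S). Then the probability that w isolates 𝓕 is at least 1 − |U|/N. -/
open scoped Classical

/-- `x` is ambiguous for `w`: some minimum set contains it and some minimum set does not. -/
def IsoBad {U : Type*} (𝓕 : Finset (Finset U)) (x : U) (w : U → ℕ) : Prop :=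
  ∃ S ∈ 𝓕, ∃ T ∈ 𝓕, x ∈ S ∧ x ∉ T ∧ (∀ R ∈ 𝓕, ∑ u ∈ S, w u ≤ ∑ u ∈ R, w u) ∧
    (∀ R ∈ 𝓕, ∑ u ∈ T, w u ≤ ∑ u ∈ R, w u)

theorem isoBad_not_lt {U : Type*} [DecidableEq U] (𝓕 : Finset (Finset U)) (x : U)
    (w w' : U → ℕ) (hw : IsoBad 𝓕 x w) (hw' : IsoBad 𝓕 x w')
    (h : ∀ u, u ≠ x → w u = w' u) : ¬ w x < w' x := by
  intro hlt
  obtain ⟨S, hS, T, hT, hxS, hxT, mS, mT⟩ := hw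
  obtain ⟨S', hS', T', hT', hxS', hxT', mS', mT'⟩ := hw'
  have e1 : ∑ u ∈ T, w u = ∑ u ∈ T, w' u :=
    Finset.sum_congr rfl fun u hu => h u (fun e => hxT (e ▸ hu))
  have e2 : ∑ u ∈ S'.erase x, w u = ∑ u ∈ S'.erase x, w' u :=
    Finset.sum_congr rfl fun u hu => h u (Finset.ne_of_mem_erase hu)
  have e3 := Finset.add_sum_erase S' w hxS'
  have e4 := Finset.add_sum_erase S' w' hxS'
  have h1 := mS' T hT
  have h2 := mT S' hS'
  omega

theorem isoBad_card {U : Type*} [Fintype U] [DecidableEq U] (N : ℕ)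
    (𝓕 : Finset (Finset U)) (x : U) :
    ((Fintype.piFinset (fun _ : U => Finset.Icc 1 N)).filter (IsoBad 𝓕 x)).card * N ≤
      (Fintype.piFinset (fun _ : U => Finset.Icc 1 N)).card := by
  have hc : N = (Finset.Icc 1 N).card := by simp
  refine le_trans (le_of_eq ((congrArg (_ * ·) hc).trans (Finset.card_product _ _).symm)) ?_
  refine Finset.card_le_card_of_injOn (fun p => Function.update p.1 x p.2) ?_ ?_
  · rintro ⟨w, k⟩ hp
    simp only [Finset.coe_product, Set.mem_prod, Finset.mem_coe, Finset.mem_filter,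
      Fintype.mem_piFinset] at hp ⊢
    intro u
    by_cases hu : u = x
    · subst hu; simpa using hp.2
    · simpa [hu] using hp.1.1 u
  · rintro ⟨w, k⟩ hp ⟨w', k'⟩ hp' he
    simp only [Finset.coe_product, Set.mem_prod, Finset.mem_coe, Finset.mem_filter] at hp hp' he
    have hk : k = k' := by simpa using congrFun he x
    have ho : ∀ u, u ≠ x → w u = w' u := fun u hu => by simpa [hu] using congrFun he u
    have h1 := isoBad_not_lt 𝓕 x w w' hp.1.2 hp'.1.2 ho
    have h2 := isoBad_not_lt 𝓕 x w' w hp'.1.2 hp.1.2 (fun u hu => (ho u hu).symm)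
    have hw : w = w' := by
      funext u
      by_cases hu : u = x
      · subst hu; omega
      · exact ho u hu
    rw [hk, hw]

theorem isoBad_exists {U : Type*} (𝓕 : Finset (Finset U)) (h𝓕 : 𝓕.Nonempty) (w : U → ℕ)
    (h : ¬ ∃! S : Finset U, S ∈ 𝓕 ∧
          ∑ u ∈ S, w u = 𝓕.inf' h𝓕 (fun T => ∑ u ∈ T, w u)) : ∃ x, IsoBad 𝓕 x w := by
  obtain ⟨S, hS, eS⟩ := Finset.exists_mem_eq_inf' h𝓕 (fun T => ∑ u ∈ T, w u)
  have hm : ∀ R ∈ 𝓕, 𝓕.inf' h𝓕 (fun T => ∑ u ∈ T, w u) ≤ ∑ u ∈ R, w u :=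
    fun R hR => Finset.inf'_le (fun T => ∑ u ∈ T, w u) hR
  have : ∃ T ∈ 𝓕, ∑ u ∈ T, w u = 𝓕.inf' h𝓕 (fun T => ∑ u ∈ T, w u) ∧ T ≠ S := by
    by_contra hc
    push Not at hc
    exact h ⟨S, ⟨hS, eS.symm⟩, fun T hT => hc T hT.1 hT.2⟩
  obtain ⟨T, hT, eT, hne⟩ := this
  have mS : ∀ R ∈ 𝓕, ∑ u ∈ S, w u ≤ ∑ u ∈ R, w u := fun R hR => eS ▸ hm R hR
  have mT : ∀ R ∈ 𝓕, ∑ u ∈ T, w u ≤ ∑ u ∈ R, w u := fun R hR => eT ▸ hm R hR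
  have : ∃ x, ¬ (x ∈ T ↔ x ∈ S) := by
    by_contra hc
    push Not at hc
    exact hne (Finset.ext fun x => by have := hc x; tauto)
  obtain ⟨x, hx⟩ := this
  refine ⟨x, ?_⟩
  by_cases hxS : x ∈ S
  · exact ⟨S, hS, T, hT, hxS, by tauto, mS, mT⟩
  · exact ⟨T, hT, S, hS, by tauto, hxS, mT, mS⟩

/-- Isolation Lemma (Mulmuley, Vazirani, Vazirani): if each element of a finite universe `U`
receives a weight from `{1, …, N}` uniformly and independently at random, then with
probability at least `1 - |U|/N` a nonempty family `𝓕` of subsets of `U` has a unique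
member of minimum weight. -/
theorem stmt_7 {U : Type*} [Fintype U] [DecidableEq U] (N : ℕ) (hN : 0 < N)
    (𝓕 : Finset (Finset U)) (h𝓕 : 𝓕.Nonempty) :
    1 - (Fintype.card U : ℝ) / N ≤
      (((Fintype.piFinset (fun _ : U => Finset.Icc 1 N)).filter
        (fun w => ∃! S : Finset U, S ∈ 𝓕 ∧
          ∑ u ∈ S, w u = 𝓕.inf' h𝓕 (fun T => ∑ u ∈ T, w u))).card : ℝ) /
      ((Fintype.piFinset (fun _ : U => Finset.Icc 1 N)).card : ℝ) := by
  have hb := isoBad_card (U := U) N 𝓕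
  have hpos : 0 < (Fintype.piFinset (fun _ : U => Finset.Icc 1 N)).card := by
    simp [Fintype.card_piFinset, hN]
  generalize hΩ : Fintype.piFinset (fun _ : U => Finset.Icc 1 N) = Ω at hb hpos ⊢
  have hsplit := Finset.card_filter_add_card_filter_not (s := Ω) (fun w => ∃! S : Finset U, S ∈ 𝓕 ∧
          ∑ u ∈ S, w u = 𝓕.inf' h𝓕 (fun T => ∑ u ∈ T, w u))
  have hsub : (Ω.filter (fun w => ¬ ∃! S : Finset U, S ∈ 𝓕 ∧
          ∑ u ∈ S, w u = 𝓕.inf' h𝓕 (fun T => ∑ u ∈ T, w u))).card ≤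
      ∑ x : U, (Ω.filter (IsoBad 𝓕 x)).card := by
    refine le_trans (Finset.card_le_card ?_) Finset.card_biUnion_le
    intro w hw
    rw [Finset.mem_filter] at hw
    obtain ⟨x, hx⟩ := isoBad_exists 𝓕 h𝓕 w hw.2
    exact Finset.mem_biUnion.2 ⟨x, Finset.mem_univ x, Finset.mem_filter.2 ⟨hw.1, hx⟩⟩
  have hsum : (∑ x : U, (Ω.filter (IsoBad 𝓕 x)).card) * N ≤ Fintype.card U * Ω.card := by
    rw [Finset.sum_mul]
    refine (Finset.sum_le_sum fun x _ => hb x).trans ?_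
    simp
  have hfin := (Nat.mul_le_mul_right N hsub).trans hsum
  generalize (Ω.filter (fun w => ¬ ∃! S : Finset U, S ∈ 𝓕 ∧
          ∑ u ∈ S, w u = 𝓕.inf' h𝓕 (fun T => ∑ u ∈ T, w u))).card = b at hsplit hfin
  generalize (Ω.filter (fun w => ∃! S : Finset U, S ∈ 𝓕 ∧
          ∑ u ∈ S, w u = 𝓕.inf' h𝓕 (fun T => ∑ u ∈ T, w u))).card = g at hsplit ⊢
  have hN' : (0 : ℝ) < N := by exact_mod_cast hN
  have hp' : (0 : ℝ) < Ω.card := by exact_mod_cast hpos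
  have h1 : (g : ℝ) + b = Ω.card := by exact_mod_cast hsplit
  have h2 : (b : ℝ) * N ≤ Fintype.card U * Ω.card := by exact_mod_cast hfin
  have h3 : (b : ℝ) / Ω.card ≤ Fintype.card U / N := by
    rw [div_le_div_iff₀ hp' hN']; exact h2
  have h4 : (g : ℝ) / Ω.card = 1 - b / Ω.card := by
    field_simp; linarith
  rw [h4]; linarith
end

section
/- Let U = {u₁, …, u_n} be a finite set, let X₁, …, X_m ⊆ U be subsets with X₁ ∪ ⋯ ∪ X_m = U, and let k be a natural number. Let G be the graph with vertex set {x₁, …, x_m} ∪ {u₁, …, u_n} ∪ {y}, where x_i u_j is an edge iff u_j ∈ X_i, and y x_i is an edge for every i ∈ {1,…,m}. Let S = {y, u₁, …, u_n}. Then there exist k' ≤ k indices i₁, …, i_{k'} ∈ {1,…,m} with U ⊆ X_{i₁} ∪ ⋯ ∪ X_{i_{k'}} if and only if G has a connected subgraph T with S ⊆ V(T) and |V(T)| ≤ n + k + 1. -/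
/-- The incidence graph of a set system `(U; X₁, …, X_m)` augmented with an apex vertex `y`
adjacent to every set-vertex `x_i`. Vertices: `Sum.inl i` is the set-vertex `x_i`,
`Sum.inr (Sum.inl j)` is the element-vertex `u_j`, and `Sum.inr (Sum.inr ())` is `y`. -/
def coverGraph (n m : ℕ) (X : Fin m → Finset (Fin n)) :
    SimpleGraph (Fin m ⊕ Fin n ⊕ Unit) :=
  SimpleGraph.fromRel (fun a b =>
    match a, b with
    | Sum.inl i, Sum.inr (Sum.inl j) => j ∈ X i
    | Sum.inr (Sum.inr _), Sum.inl _ => True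
    | _, _ => False)

/-- `U` can be covered by at most `k` of the sets `X₁, …, X_m` iff the graph `coverGraph`
has a connected subgraph containing `S = {y, u₁, …, u_n}` with at most `n + k + 1`
vertices. -/
theorem stmt_10 (n m k : ℕ) (X : Fin m → Finset (Fin n))
    (hcov : ∀ j : Fin n, ∃ i : Fin m, j ∈ X i) :
    (∃ I : Finset (Fin m), I.card ≤ k ∧ ∀ j : Fin n, ∃ i ∈ I, j ∈ X i) ↔
    (∃ T : (coverGraph n m X).Subgraph, T.coe.Connected ∧
      ({v | v = Sum.inr (Sum.inr ()) ∨ ∃ j : Fin n, v = Sum.inr (Sum.inl j)} :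
        Set (Fin m ⊕ Fin n ⊕ Unit)) ⊆ T.verts ∧
      T.verts.ncard ≤ n + k + 1) := by
  constructor
  · rintro ⟨I, hI, hc⟩
    let F : Finset (Fin m ⊕ Fin n ⊕ Unit) := I.disjSum Finset.univ
    refine ⟨(⊤ : (coverGraph n m X).Subgraph).induce (F : Set _), ?_, ?_, ?_⟩
    · rw [SimpleGraph.connected_iff_exists_forall_reachable]
      have hy : (Sum.inr (Sum.inr ()) : Fin m ⊕ Fin n ⊕ Unit) ∈ F := by simp [F]
      have hx : ∀ i (hi : (Sum.inl i : Fin m ⊕ Fin n ⊕ Unit) ∈ F),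
          ((⊤ : (coverGraph n m X).Subgraph).induce (F : Set (Fin m ⊕ Fin n ⊕ Unit))).coe.Reachable
            ⟨Sum.inr (Sum.inr ()), hy⟩ ⟨Sum.inl i, hi⟩ := by
        intro i hi
        apply SimpleGraph.Adj.reachable
        rw [SimpleGraph.Subgraph.coe_adj]
        exact ⟨hy, hi, by rw [SimpleGraph.Subgraph.top_adj]; simp [coverGraph]⟩
      refine ⟨⟨Sum.inr (Sum.inr ()), hy⟩, ?_⟩
      rintro ⟨i | j | u, hv⟩
      · exact hx i hv
      · obtain ⟨i, hi, hj⟩ := hc j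
        have hi' : (Sum.inl i : Fin m ⊕ Fin n ⊕ Unit) ∈ F := by simp [F, hi]
        refine (hx i hi').trans ?_
        apply SimpleGraph.Adj.reachable
        rw [SimpleGraph.Subgraph.coe_adj]
        exact ⟨hi', hv, by rw [SimpleGraph.Subgraph.top_adj]; simp [coverGraph, hj]⟩
      · exact SimpleGraph.Reachable.refl _
    · rintro v (rfl | ⟨j, rfl⟩) <;> simp [F]
    · rw [SimpleGraph.Subgraph.induce_verts, Set.ncard_coe_finset, Finset.card_disjSum]
      simp
      omega
  · rintro ⟨T, hT, hS, hcard⟩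
    classical
    let I : Finset (Fin m) := Finset.univ.filter (fun i => Sum.inl i ∈ T.verts)
    refine ⟨I, ?_, ?_⟩
    · let F : Finset (Fin m ⊕ Fin n ⊕ Unit) := I.disjSum Finset.univ
      have hF : (F : Set _) ⊆ T.verts := by
        rintro (i | j | u) hv
        · simpa [F, I] using hv
        · exact hS (Or.inr ⟨j, rfl⟩)
        · exact hS (Or.inl rfl)
      have h := Set.ncard_le_ncard hF (Set.toFinite _)
      rw [Set.ncard_coe_finset, Finset.card_disjSum] at h
      simp at h
      omega
    · intro j
      have hj : Sum.inr (Sum.inl j) ∈ T.verts := hS (Or.inr ⟨j, rfl⟩)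
      have hy : Sum.inr (Sum.inr ()) ∈ T.verts := hS (Or.inl rfl)
      obtain ⟨w⟩ := hT.preconnected ⟨_, hj⟩ ⟨_, hy⟩
      cases w with
      | @cons _ v _ h _ =>
        obtain ⟨v, hv⟩ := v
        have h' := T.adj_sub h
        rcases v with i | j' | u
        · exact ⟨i, by simpa [I] using hv, by simpa [coverGraph] using h'⟩
        · simp [coverGraph] at h'
        · simp [coverGraph] at h'
end

section
/- For all natural numbers n and k with k ≤ n and (k : ℝ) ≥ 0.8983 · n, one has (3 : ℝ)^(k/3) ≥ binom(n, n − k), where the left-hand side is the real power 3^{k/3} and binom denotes the binomial coefficient. -/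
/-- The balancing inequality `3^{k/3} ≥ binom(n, n-k)` for `k ≥ 0.8983 n`. -/
theorem stmt_12 (n k : ℕ) (hkn : k ≤ n) (hk : (0.8983 : ℝ) * n ≤ k) :
    ((n.choose (n - k) : ℕ) : ℝ) ≤ (3 : ℝ) ^ ((k : ℝ) / 3) := by
  have hk' : 8983 * n ≤ 10000 * k := by
    have : (8983 : ℝ) * n ≤ 10000 * k := by linarith
    exact_mod_cast this
  rw [Nat.choose_symm hkn]
  generalize hC : n.choose k = C
  have h1 : 9 ^ k * C ≤ 10 ^ n := by
    have h := add_pow (9 : ℕ) 1 n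
    have h2 := Finset.single_le_sum
      (f := fun m => (9 : ℕ) ^ m * 1 ^ (n - m) * (n.choose m)) (s := Finset.range (n + 1))
      (fun i _ => Nat.zero_le _) (Finset.mem_range.mpr (Nat.lt_succ_of_le hkn))
    simp only [Nat.cast_id] at h
    rw [← h] at h2
    simpa [hC] using h2
  have h10 : (10 : ℕ) ^ 125 ≤ 3 ^ 262 := by
    rw [show (3 : ℕ) ^ 262 = (3 ^ 131) ^ 2 by rw [← pow_mul]]; norm_num
  have h2 : (9 ^ k * C) ^ 375 ≤ 3 ^ (875 * k) := calc
    (9 ^ k * C) ^ 375 ≤ (10 ^ n) ^ 375 := Nat.pow_le_pow_left h1 _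
    _ = (10 ^ 125) ^ (3 * n) := by rw [← pow_mul, ← pow_mul]; congr 1; ring
    _ ≤ (3 ^ 262) ^ (3 * n) := Nat.pow_le_pow_left h10 _
    _ = 3 ^ (786 * n) := by rw [← pow_mul]; congr 1; ring
    _ ≤ 3 ^ (875 * k) := Nat.pow_le_pow_right (by norm_num) (by omega)
  have h3 : (C ^ 3) ^ 125 ≤ (3 ^ k) ^ 125 := by
    have e1 : (9 ^ k * C) ^ 375 = 3 ^ (750 * k) * (C ^ 3) ^ 125 := by
      rw [mul_pow, show (9 : ℕ) = 3 ^ 2 by norm_num, ← pow_mul, ← pow_mul, ← pow_mul]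
      congr 2; ring
    have e2 : 3 ^ (875 * k) = 3 ^ (750 * k) * (3 ^ k) ^ 125 := by
      rw [← pow_mul, ← pow_add]; congr 1; ring
    rw [e1, e2] at h2
    exact Nat.le_of_mul_le_mul_left h2 (by positivity)
  have h4 : C ^ 3 ≤ 3 ^ k := (Nat.pow_le_pow_iff_left (by norm_num)).mp h3
  have h5 : (C : ℝ) ^ 3 ≤ ((3 : ℝ) ^ ((k : ℝ) / 3)) ^ 3 := by
    rw [← Real.rpow_mul_natCast (by norm_num)]
    have : (k : ℝ) / 3 * ((3 : ℕ) : ℝ) = (k : ℝ) := by push_cast; ring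
    rw [this, Real.rpow_natCast]
    exact_mod_cast h4
  exact le_of_pow_le_pow_left₀ (by norm_num) (by positivity) h5
end

section
/- For all natural numbers n and k with k ≤ n and (k : ℝ) ≥ 0.77923 · n, one has (2 : ℝ)^k ≥ binom(n, n − k), where binom denotes the binomial coefficient. -/
/-- The balancing inequality `2^k ≥ binom(n, n-k)` for `k ≥ 0.77923 n`. -/
theorem stmt_13 (n k : ℕ) (hkn : k ≤ n) (hk : (0.77923 : ℝ) * n ≤ k) :
    ((n.choose (n - k) : ℕ) : ℝ) ≤ (2 : ℝ) ^ k := by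
  have h79 : 7 * n ≤ 9 * k := by
    have h : (7 : ℝ) * n ≤ 9 * k := by
      have : (0 : ℝ) ≤ n := Nat.cast_nonneg n
      linarith
    exact_mod_cast h
  have h1 : 7 ^ k * 2 ^ (n - k) * n.choose k ≤ 9 ^ n := by
    have h := add_pow (7 : ℕ) 2 n
    norm_num at h
    rw [h]
    exact Finset.single_le_sum (f := fun m => 7 ^ m * 2 ^ (n - m) * n.choose m)
      (fun _ _ => Nat.zero_le _) (Finset.mem_range.mpr (by omega))
  have h2 : 9 ^ n ≤ 2 ^ n * 7 ^ k := by
    have h : (9 ^ n) ^ 9 ≤ (2 ^ n * 7 ^ k) ^ 9 := by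
      calc (9 ^ n) ^ 9 = (9 ^ 9) ^ n := by rw [← pow_mul, ← pow_mul, mul_comm]
        _ ≤ (2 ^ 9 * 7 ^ 7) ^ n := Nat.pow_le_pow_left (by norm_num) n
        _ = 2 ^ (9 * n) * 7 ^ (7 * n) := by rw [mul_pow, ← pow_mul, ← pow_mul]
        _ ≤ 2 ^ (9 * n) * 7 ^ (9 * k) :=
          Nat.mul_le_mul_left _ (Nat.pow_le_pow_right (by norm_num) h79)
        _ = (2 ^ n * 7 ^ k) ^ 9 := by
          rw [mul_pow, ← pow_mul, ← pow_mul, mul_comm n, mul_comm k]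
    exact le_of_pow_le_pow_left₀ (by norm_num) (Nat.zero_le _) h
  have h3 : 2 ^ n = 2 ^ (n - k) * 2 ^ k := by
    rw [← pow_add]; congr 1; omega
  have h4 : n.choose (n - k) ≤ 2 ^ k := by
    rw [Nat.choose_symm hkn]
    have hp : 0 < 7 ^ k * 2 ^ (n - k) := by positivity
    refine le_of_mul_le_mul_left ?_ hp
    calc _ ≤ 9 ^ n := h1
      _ ≤ _ := h2
      _ = _ := by rw [h3]; ring
  exact_mod_cast h4
end

section
/- Let G be a finite simple graph, let v ∈ V(G), and let b, f ≥ 0 be integers. Then the number of sets B ⊆ V(G) such that v ∈ B, the induced subgraph G[B] is connected, |B| = b + 1, and |N_G(B)| = f, is at most binom(b + f, b). -/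
/-- Open neighborhood. -/
def nbhd14 {V : Type*} (G : SimpleGraph V) (B : Set V) : Set V := {u | u ∉ B ∧ ∃ w ∈ B, G.Adj w u}

theorem eq_of_conn14 {V : Type*} (G : SimpleGraph V) (B S : Set V) (v : V) (hv : v ∈ S) (hSB : S ⊆ B)
    (hc : (G.induce B).Connected) (h : ∀ u ∈ nbhd14 G S, u ∉ B) : B = S := by
  refine Set.Subset.antisymm ?_ hSB
  intro x hx
  by_contra hxS
  obtain ⟨p⟩ := hc.preconnected ⟨v, hSB hv⟩ ⟨x, hx⟩
  obtain ⟨d, -, h1, h2⟩ := p.exists_boundary_dart (Subtype.val ⁻¹' S) hv hxS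
  exact h d.snd.1 ⟨h2, d.fst.1, h1, d.adj⟩ d.snd.2

/-- The family counted in the branching argument. -/
def fam14 {V : Type*} (G : SimpleGraph V) (S F : Set V) (p q : ℕ) : Set (Set V) :=
  {B | S ⊆ B ∧ (∀ x ∈ F, x ∉ B) ∧ (G.induce B).Connected ∧ B.ncard = S.ncard + p ∧
    (nbhd14 G B).ncard = F.ncard + q}

theorem branch14 {V : Type*} [Fintype V] (G : SimpleGraph V) (v : V) (n : ℕ) :
    ∀ (p q : ℕ), p + q = n → ∀ S F : Set V, v ∈ S → F ⊆ nbhd14 G S →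
      (fam14 G S F p q).ncard ≤ (p + q).choose p := by
  induction n with
  | zero =>
    intro p q hpq S F hv hF
    obtain ⟨rfl, rfl⟩ : p = 0 ∧ q = 0 := by omega
    have : fam14 G S F 0 0 ⊆ {S} := by
      rintro B ⟨h1, -, -, h4, -⟩
      exact (Set.eq_of_subset_of_ncard_le h1 (by omega) (Set.toFinite _)).symm
    simpa using Set.ncard_le_ncard this
  | succ n ih =>
    intro p q hpq S F hv hF
    by_cases hu : ∃ u ∈ nbhd14 G S, u ∉ F
    swap
    · push Not at hu
      have : fam14 G S F p q ⊆ {S} := by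
        rintro B ⟨h1, h2, h3, -, -⟩
        exact eq_of_conn14 G B S v hv h1 h3 fun u h => h2 u (hu u h)
      have h1 := Set.ncard_le_ncard this
      rw [Set.ncard_singleton] at h1
      exact h1.trans (Nat.choose_pos (by omega))
    obtain ⟨u, huN, huF⟩ := hu
    have hFB : ∀ B : Set V, S ⊆ B → ∀ x ∈ nbhd14 G S, x ∉ B → x ∈ nbhd14 G B := by
      rintro B h x ⟨-, w, hw, ha⟩ hx
      exact ⟨hx, w, h hw, ha⟩
    have hSc : (insert u S).ncard = S.ncard + 1 := Set.ncard_insert_of_notMem huN.1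
    have hFc : (insert u F).ncard = F.ncard + 1 := Set.ncard_insert_of_notMem huF
    have hF1 : F ⊆ nbhd14 G (insert u S) := fun x hx =>
      hFB _ (Set.subset_insert _ _) x (hF hx) (by
        rintro (rfl | h)
        · exact huF hx
        · exact (hF hx).1 h)
    have hF2 : insert u F ⊆ nbhd14 G S := Set.insert_subset huN hF
    have key1 : ∀ B ∈ fam14 G S F p q, u ∈ B →
        ∃ p', p = p' + 1 ∧ B ∈ fam14 G (insert u S) F p' q := by
      rintro B ⟨h1, h2, h3, h4, h5⟩ hB
      have hs : insert u S ⊆ B := Set.insert_subset hB h1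
      have := Set.ncard_le_ncard hs
      exact ⟨p - 1, by omega, hs, h2, h3, by omega, h5⟩
    have key2 : ∀ B ∈ fam14 G S F p q, u ∉ B →
        ∃ q', q = q' + 1 ∧ B ∈ fam14 G S (insert u F) p q' := by
      rintro B ⟨h1, h2, h3, h4, h5⟩ hB
      have hd : ∀ x ∈ insert u F, x ∉ B := by
        rintro x (rfl | h)
        · exact hB
        · exact h2 x h
      have hs : insert u F ⊆ nbhd14 G B := fun x hx => hFB B h1 x (hF2 hx) (hd x hx)
      have := Set.ncard_le_ncard hs
      exact ⟨q - 1, by omega, h1, hd, h3, h4, by omega⟩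
    rcases p with _ | p
    · rcases q with _ | q
      · omega
      have : fam14 G S F 0 (q+1) ⊆ fam14 G S (insert u F) 0 q := by
        intro B hB
        by_cases h : u ∈ B
        · obtain ⟨p', h, -⟩ := key1 B hB h
          omega
        · obtain ⟨q', h, h'⟩ := key2 B hB h
          obtain rfl : q = q' := by omega
          exact h'
      refine (Set.ncard_le_ncard this).trans ((ih 0 q (by omega) S _ hv hF2).trans ?_)
      simp
    · rcases q with _ | q
      · have : fam14 G S F (p+1) 0 ⊆ fam14 G (insert u S) F p 0 := by
          intro B hB
          by_cases h : u ∈ B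
          · obtain ⟨p', h, h'⟩ := key1 B hB h
            obtain rfl : p = p' := by omega
            exact h'
          · obtain ⟨q', h, h'⟩ := key2 B hB h
            omega
        refine (Set.ncard_le_ncard this).trans
          ((ih p 0 (by omega) _ F (Set.mem_insert_of_mem _ hv) hF1).trans ?_)
        simp
      · have : fam14 G S F (p+1) (q+1) ⊆
            fam14 G (insert u S) F p (q+1) ∪ fam14 G S (insert u F) (p+1) q := by
          intro B hB
          by_cases h : u ∈ B
          · obtain ⟨p', h, h'⟩ := key1 B hB h
            obtain rfl : p = p' := by omega
            exact Or.inl h'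
          · obtain ⟨q', h, h'⟩ := key2 B hB h
            obtain rfl : q = q' := by omega
            exact Or.inr h'
        have a1 := ih p (q+1) (by omega) _ F (Set.mem_insert_of_mem _ hv) hF1
        have a2 := ih (p+1) q (by omega) S _ hv hF2
        have a3 := (Set.ncard_le_ncard this).trans (Set.ncard_union_le _ _)
        have e : (p + 1 + (q + 1)).choose (p+1) =
            (p + (q+1)).choose p + (p + 1 + q).choose (p+1) := by
          rw [show p + 1 + (q + 1) = (p + (q+1)) + 1 by omega, Nat.choose_succ_succ,
            show p + 1 + q = p + (q+1) by omega]
        omega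

/-- Proposition (Fomin–Villanger): the number of connected vertex sets `B` containing `v`
with `|B| = b + 1` and `|N_G(B)| = f` is at most `binom(b + f, b)`. -/
theorem stmt_14 {V : Type*} [Fintype V] (G : SimpleGraph V) (v : V) (b f : ℕ) :
    {B : Set V | v ∈ B ∧ (G.induce B).Connected ∧ B.ncard = b + 1 ∧
      {u | u ∉ B ∧ ∃ w ∈ B, G.Adj w u}.ncard = f}.ncard ≤ (b + f).choose b := by
  refine (Set.ncard_le_ncard ?_).trans
    (branch14 G v (b + f) b f rfl {v} ∅ rfl (Set.empty_subset _))
  rintro B ⟨h1, h2, h3, h4⟩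
  refine ⟨Set.singleton_subset_iff.2 h1, by simp, h2, ?_, ?_⟩
  · rw [Set.ncard_singleton]; omega
  · rw [Set.ncard_empty, zero_add]; exact h4
end

section
/- Let G be a finite simple graph, let v ∈ V(G), and let k be a positive integer. Then the number of sets B ⊆ V(G) such that v ∈ B, the induced subgraph G[B] is connected, and |N_G[B]| ≤ k, is at most 2^k · k². -/
lemma branch_aux {V : Type*} [Fintype V] (G : SimpleGraph V) (k : ℕ) (n : ℕ) :
    ∀ A F : Set V, A.Nonempty → Disjoint A F → (∀ u ∈ F, ∃ w ∈ A, G.Adj w u) →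
      A.ncard + F.ncard + n = k →
      {B : Set V | A ⊆ B ∧ Disjoint B F ∧ (G.induce B).Connected ∧
        (B ∪ {u | ∃ w ∈ B, G.Adj w u}).ncard ≤ k}.ncard ≤ 2 ^ n := by
  induction n with
  | zero =>
    intro A F hA hd hF hc
    refine (Set.ncard_le_ncard (t := {A}) ?_).trans (by simp)
    rintro B ⟨hAB, hBF, hconn, hk⟩
    by_contra hne
    obtain ⟨b, hb, hbA⟩ := Set.not_subset.1 (fun h => hne (Set.Subset.antisymm h hAB))
    obtain ⟨a, ha⟩ := hA
    obtain ⟨p⟩ := hconn.preconnected ⟨a, hAB ha⟩ ⟨b, hb⟩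
    obtain ⟨d, -, h1, h2⟩ := p.exists_boundary_dart {x | x.1 ∈ A} ha hbA
    have hadj : G.Adj d.fst.1 d.snd.1 := d.adj
    have hnF : d.snd.1 ∉ F := fun h => Set.disjoint_left.1 hBF d.snd.2 h
    have hsub : insert d.snd.1 (A ∪ F) ⊆ B ∪ {u | ∃ w ∈ B, G.Adj w u} := by
      rintro x (rfl | hx | hx)
      · exact Or.inl d.snd.2
      · exact Or.inl (hAB hx)
      · obtain ⟨w, hw, h⟩ := hF x hx
        exact Or.inr ⟨w, hAB hw, h⟩
    have h3 := Set.ncard_le_ncard hsub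
    rw [Set.ncard_insert_of_notMem (by rintro (h | h); exacts [h2 h, hnF h]),
      Set.ncard_union_eq hd] at h3
    omega
  | succ n ih =>
    intro A F hA hd hF hc
    by_cases hu : ∃ u, u ∉ A ∧ u ∉ F ∧ ∃ w ∈ A, G.Adj w u
    · obtain ⟨u, huA, huF, hw⟩ := hu
      have i1 := ih (insert u A) F (Set.insert_nonempty _ _)
        (by rw [Set.disjoint_insert_left]; exact ⟨huF, hd⟩)
        (fun x hx => by
          obtain ⟨w, hw, h⟩ := hF x hx
          exact ⟨w, Or.inr hw, h⟩)
        (by rw [Set.ncard_insert_of_notMem huA]; omega)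
      have i2 := ih A (insert u F) hA
        (by rw [Set.disjoint_insert_right]; exact ⟨huA, hd⟩)
        (by
          rintro x (rfl | hx)
          · exact hw
          · exact hF x hx)
        (by rw [Set.ncard_insert_of_notMem huF]; omega)
      rw [pow_succ, mul_two]
      refine le_trans ?_ (add_le_add i1 i2)
      refine le_trans (Set.ncard_le_ncard ?_) (Set.ncard_union_le _ _)
      rintro B ⟨hAB, hBF, hconn, hk⟩
      by_cases hb : u ∈ B
      · exact Or.inl ⟨Set.insert_subset hb hAB, hBF, hconn, hk⟩
      · exact Or.inr ⟨hAB, by rw [Set.disjoint_insert_right]; exact ⟨hb, hBF⟩, hconn, hk⟩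
    · refine (Set.ncard_le_ncard (t := {A}) ?_).trans (by simp [Nat.one_le_two_pow])
      rintro B ⟨hAB, hBF, hconn, hk⟩
      by_contra hne
      obtain ⟨b, hb, hbA⟩ := Set.not_subset.1 (fun h => hne (Set.Subset.antisymm h hAB))
      obtain ⟨a, ha⟩ := hA
      obtain ⟨p⟩ := hconn.preconnected ⟨a, hAB ha⟩ ⟨b, hb⟩
      obtain ⟨d, -, h1, h2⟩ := p.exists_boundary_dart {x | x.1 ∈ A} ha hbA
      have hadj : G.Adj d.fst.1 d.snd.1 := d.adj
      exact hu ⟨d.snd.1, h2, fun h => Set.disjoint_left.1 hBF d.snd.2 h, d.fst.1, h1, hadj⟩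

/-- The number of connected vertex sets `B` containing `v` with `|N_G[B]| ≤ k` is at most
`2^k · k²`. -/
theorem stmt_15 {V : Type*} [Fintype V] (G : SimpleGraph V) (v : V) (k : ℕ) (hk : 1 ≤ k) :
    {B : Set V | v ∈ B ∧ (G.induce B).Connected ∧
      (B ∪ {u | ∃ w ∈ B, G.Adj w u}).ncard ≤ k}.ncard ≤ 2 ^ k * k ^ 2 := by
  have h := branch_aux G k (k - 1) {v} ∅ (Set.singleton_nonempty v) (Set.disjoint_empty _)
    (by simp) (by simp; omega)
  simp only [Set.singleton_subset_iff, Set.disjoint_empty, true_and] at h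
  refine h.trans ?_
  calc 2 ^ (k - 1) ≤ 2 ^ k := Nat.pow_le_pow_right (by norm_num) (by omega)
    _ ≤ 2 ^ k * k ^ 2 := Nat.le_mul_of_pos_right _ (by positivity)
end

section
/- Let f : ℕ → ℝ be a function such that f(0) ≤ 1 and for every k ≥ 1 there exists an integer d with 1 ≤ d ≤ k and f(k) ≤ d · f(k − d). Then for every natural number k, f(k) ≤ (3 : ℝ)^(k/3), where the right-hand side is the real power 3^{k/3}. -/
theorem cube_le_three_pow (d : ℕ) : d ^ 3 ≤ 3 ^ d := by
  rcases lt_or_ge d 3 with h | h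
  · interval_cases d <;> norm_num
  · induction d, h using Nat.le_induction with
    | base => norm_num
    | succ n hn ih =>
      have h1 : (n + 1) ^ 3 ≤ 3 * n ^ 3 := by
        obtain ⟨m, rfl⟩ := Nat.exists_eq_add_of_le hn
        ring_nf
        nlinarith [Nat.zero_le (m ^ 3), Nat.zero_le (m ^ 2), Nat.zero_le m]
      rw [pow_succ 3 n]
      omega

theorem le_three_rpow (d : ℕ) : (d : ℝ) ≤ (3 : ℝ) ^ ((d : ℝ) / 3) := by
  have h : ((d : ℝ)) ^ 3 ≤ ((3 : ℝ) ^ ((d : ℝ) / 3)) ^ 3 := by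
    rw [← Real.rpow_natCast ((3 : ℝ) ^ ((d : ℝ) / 3)) 3, ← Real.rpow_mul (by norm_num)]
    have e : (d : ℝ) / 3 * ((3 : ℕ) : ℝ) = (d : ℝ) := by push_cast; ring
    rw [e, Real.rpow_natCast]
    exact_mod_cast cube_le_three_pow d
  exact le_of_pow_le_pow_left₀ (by norm_num) (by positivity) h

/-- Solution of the branching recurrence `t(k) ≤ d · t(k - d)`: any function satisfying it
with `f 0 ≤ 1` is bounded by `3^{k/3}`. -/
theorem stmt_16 (f : ℕ → ℝ) (h0 : f 0 ≤ 1)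
    (hrec : ∀ k : ℕ, 1 ≤ k → ∃ d : ℕ, 1 ≤ d ∧ d ≤ k ∧ f k ≤ d * f (k - d)) :
    ∀ k : ℕ, f k ≤ (3 : ℝ) ^ ((k : ℝ) / 3) := by
  intro k
  induction k using Nat.strong_induction_on with
  | _ k ih =>
    rcases Nat.eq_zero_or_pos k with rfl | hk
    · simpa using h0
    · obtain ⟨d, hd1, hdk, hf⟩ := hrec k hk
      have h1 := ih (k - d) (by omega)
      calc f k ≤ d * f (k - d) := hf
        _ ≤ d * (3 : ℝ) ^ (((k - d : ℕ) : ℝ) / 3) := by gcongr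
        _ ≤ (3 : ℝ) ^ ((d : ℝ) / 3) * (3 : ℝ) ^ (((k - d : ℕ) : ℝ) / 3) := by
          gcongr
          exact le_three_rpow d
        _ = (3 : ℝ) ^ ((k : ℝ) / 3) := by
          rw [← Real.rpow_add (by norm_num), Nat.cast_sub hdk]
          congr 1
          ring
end
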